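/- The Hausdorff dimension of the middle-thirds Cantor set C equals log 2 / log 3, the unique nonnegative solution s of the Moran equation 2·(1/3)^s = 1 for its defining ISS of two similarities of ratio 1/3. -/

import Mathlib

open Real Set MeasureTheory Filter Topology
open scoped NNReal ENNReal

theorem Real.three_rpow_log_two_div_log_three : (3 : ℝ) ^ (log 2 / log 3) = 2 := by
  rw [rpow_def_of_pos (by norm_num), mul_div_cancel₀ _ (log_pos (by norm_num)).ne',
    exp_log (by norm_num)]

theorem Real.inv_three_pow_rpow_log_two_div_log_three (n : ℕ) :
    (((3 : ℝ) ^ n)⁻¹) ^ (log 2 / log 3) = ((2 : ℝ) ^ n)⁻¹ := by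
  rw [inv_rpow (by positivity), ← rpow_natCast, ← rpow_mul (by norm_num), mul_comm,
    rpow_mul (by norm_num), three_rpow_log_two_div_log_three, rpow_natCast]

/-- The point of the Cantor set whose ternary digits are `2` where `b` is true and `0` elsewhere. -/
noncomputable def cantorPoint (b : ℕ → Bool) : ℝ :=
  ofDigits fun i ↦ cond (b i) (2 : Fin 3) 0

/-- The number whose binary digits are `1` where `b` is true and `0` elsewhere. -/
noncomputable def binaryPoint (b : ℕ → Bool) : ℝ :=
  ofDigits fun i ↦ cond (b i) (1 : Fin 2) 0

theorem range_cantorPoint : range cantorPoint = cantorSet := by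
  ext x
  constructor
  · rintro ⟨b, rfl⟩
    exact ofDigits_bool_to_fin_three_mem_cantorSet b
  · exact fun hx ↦ ⟨(cantorToBinary x).get, ofDigits_cantorToTernary hx⟩

theorem range_binaryPoint : range binaryPoint = Icc 0 1 := by
  ext x
  constructor
  · rintro ⟨b, rfl⟩
    exact ⟨ofDigits_nonneg _, ofDigits_le_one _⟩
  · intro hx
    obtain ⟨d, -, rfl⟩ := ofDigits_SurjOn one_lt_two hx
    refine ⟨fun i ↦ decide (d i = 1), congrArg ofDigits (funext fun i ↦ ?_)⟩
    beta_reduce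
    generalize d i = k
    fin_cases k <;> rfl

theorem abs_cantorPoint_sub_le {b c : ℕ → Bool} {n : ℕ} (h : ∀ i < n, b i = c i) :
    |cantorPoint b - cantorPoint c| ≤ ((3 : ℝ) ^ n)⁻¹ :=
  abs_ofDigits_sub_ofDigits_le fun i hi ↦ by rw [h i hi]

theorem abs_binaryPoint_sub_le {b c : ℕ → Bool} {n : ℕ} (h : ∀ i < n, b i = c i) :
    |binaryPoint b - binaryPoint c| ≤ ((2 : ℝ) ^ n)⁻¹ :=
  abs_ofDigits_sub_ofDigits_le fun i hi ↦ by rw [h i hi]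

theorem le_abs_cantorPoint_sub {b c : ℕ → Bool} {n : ℕ} (h : ∀ i < n, b i = c i)
    (hn : b n ≠ c n) : ((3 : ℝ) ^ (n + 1))⁻¹ ≤ |cantorPoint b - cantorPoint c| := by
  wlog hb : b n = true generalizing b c
  · rw [abs_sub_comm]
    exact this (fun i hi ↦ (h i hi).symm) hn.symm (by grind)
  have hc : c n = false := by grind
  have hsum : ∑ i ∈ Finset.range n, ofDigitsTerm (fun i ↦ cond (b i) (2 : Fin 3) 0) i =
      ∑ i ∈ Finset.range n, ofDigitsTerm (fun i ↦ cond (c i) (2 : Fin 3) 0) i :=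
    Finset.sum_congr rfl fun i hi ↦ by simp [ofDigitsTerm, h i (Finset.mem_range.mp hi)]
  refine le_trans ?_ (le_abs_self _)
  rw [cantorPoint, cantorPoint, ofDigits_eq_sum_add_ofDigits _ (n + 1),
    ofDigits_eq_sum_add_ofDigits (fun i ↦ cond (c i) (2 : Fin 3) 0) (n + 1),
    Finset.sum_range_succ, Finset.sum_range_succ, hsum]
  have hu := ofDigits_nonneg fun i ↦ cond (b (i + (n + 1))) (2 : Fin 3) 0
  have hv := ofDigits_le_one fun i ↦ cond (c (i + (n + 1))) (2 : Fin 3) 0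
  have hp : (0 : ℝ) < ((3 : ℝ) ^ (n + 1))⁻¹ := by positivity
  simp only [ofDigitsTerm, hb, hc, cond_true, cond_false, Fin.val_two, Fin.val_zero,
    Nat.cast_ofNat, Nat.cast_zero]
  nlinarith [mul_nonneg hp.le hu, mul_le_mul_of_nonneg_left hv hp.le]

theorem abs_binaryPoint_sub_le_rpow (b c : ℕ → Bool) :
    |binaryPoint b - binaryPoint c| ≤
      2 * |cantorPoint b - cantorPoint c| ^ (log 2 / log 3) := by
  by_cases hbc : b = c
  · subst hbc
    simp only [sub_self, abs_zero]
    positivity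
  have hex : ∃ n, b n ≠ c n := Function.ne_iff.mp hbc
  have h : ∀ i < Nat.find hex, b i = c i := fun i hi ↦ not_not.mp (Nat.find_min hex hi)
  calc |binaryPoint b - binaryPoint c|
      ≤ ((2 : ℝ) ^ Nat.find hex)⁻¹ := abs_binaryPoint_sub_le h
    _ = 2 * (((3 : ℝ) ^ (Nat.find hex + 1))⁻¹) ^ (log 2 / log 3) := by
      rw [inv_three_pow_rpow_log_two_div_log_three, pow_succ]
      field_simp
    _ ≤ _ := by
      gcongr
      exact le_abs_cantorPoint_sub h (Nat.find_spec hex)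

theorem dimH_Icc_zero_one : dimH (Icc (0 : ℝ) 1) = 1 := by
  rw [Real.dimH_of_nonempty_interior (by simp)]
  simp

theorem le_dimH_cantorSet : ENNReal.ofReal (log 2 / log 3) ≤ dimH cantorSet := by
  have hs : 0 < log 2 / log 3 := div_pos (log_pos (by norm_num)) (log_pos (by norm_num))
  let g : ℝ → ℝ := fun x ↦ binaryPoint (cantorToBinary x).get
  have hleft : ∀ x ∈ cantorSet, cantorPoint (cantorToBinary x).get = x :=
    fun x hx ↦ ofDigits_cantorToTernary hx
  have hg : HolderOnWith 2 (log 2 / log 3).toNNReal g cantorSet := by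
    intro x hx y hy
    have h := abs_binaryPoint_sub_le_rpow (cantorToBinary x).get (cantorToBinary y).get
    rw [hleft x hx, hleft y hy] at h
    rw [edist_dist, edist_dist, Real.dist_eq, Real.dist_eq, Real.coe_toNNReal _ hs.le,
      ENNReal.ofReal_rpow_of_nonneg (abs_nonneg _) hs.le]
    refine (ENNReal.ofReal_le_ofReal h).trans_eq ?_
    rw [ENNReal.ofReal_mul (by norm_num)]
    simp
  have himage : Icc 0 1 ⊆ g '' cantorSet := by
    rw [← range_binaryPoint]
    rintro _ ⟨b, rfl⟩
    refine ⟨cantorPoint b, ofDigits_bool_to_fin_three_mem_cantorSet b, ?_⟩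
    exact congrArg binaryPoint (cantorSetEquivNatToBool.right_inv b)
  have h := (dimH_mono himage).trans (hg.dimH_image_le (Real.toNNReal_pos.mpr hs))
  rw [dimH_Icc_zero_one, ENNReal.le_div_iff_mul_le (by simp [hs]) (by simp), one_mul] at h
  exact h

theorem hausdorffMeasure_cantorSet_le_one : μH[log 2 / log 3] cantorSet ≤ 1 := by
  have hs : 0 < log 2 / log 3 := div_pos (log_pos (by norm_num)) (log_pos (by norm_num))
  let r : ℕ → ℝ≥0∞ := fun n ↦ ENNReal.ofReal (((3 : ℝ) ^ n)⁻¹)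
  let t : ∀ n : ℕ, (Fin n → Bool) → Set ℝ := fun n w ↦
    cantorPoint '' {b | ∀ i : Fin n, b i = w i}
  have hr : Tendsto r atTop (𝓝 0) := by
    rw [← ENNReal.ofReal_zero]
    refine ENNReal.tendsto_ofReal ?_
    simp_rw [← inv_pow]
    exact tendsto_pow_atTop_nhds_zero_of_lt_one (by norm_num) (by norm_num)
  have ht : ∀ n w, Metric.ediam (t n w) ≤ r n := by
    refine fun n w ↦ Metric.ediam_le ?_
    rintro _ ⟨b, hb, rfl⟩ _ ⟨c, hc, rfl⟩
    rw [edist_dist, Real.dist_eq]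
    exact ENNReal.ofReal_le_ofReal <| abs_cantorPoint_sub_le fun i hi ↦
      (hb ⟨i, hi⟩).trans (hc ⟨i, hi⟩).symm
  have hcover : ∀ n, cantorSet ⊆ ⋃ w, t n w := by
    intro n
    rw [← range_cantorPoint]
    rintro _ ⟨b, rfl⟩
    exact mem_iUnion.mpr ⟨fun i ↦ b i, b, fun _ ↦ rfl, rfl⟩
  refine (Measure.hausdorffMeasure_le_liminf_sum _ _ r hr t (.of_forall ht)
    (.of_forall hcover)).trans ?_
  refine (liminf_le_liminf (v := fun _ ↦ 1) (.of_forall fun n ↦ ?_)).trans_eq (liminf_const 1)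
  calc ∑ w, Metric.ediam (t n w) ^ (log 2 / log 3)
      ≤ ∑ _w : Fin n → Bool, r n ^ (log 2 / log 3) := by
        gcongr with w
        exact ht n w
    _ = ENNReal.ofReal (2 ^ n * ((2 : ℝ) ^ n)⁻¹) := by
      rw [ENNReal.ofReal_rpow_of_nonneg (by positivity) hs.le,
        inv_three_pow_rpow_log_two_div_log_three, ENNReal.ofReal_mul (by positivity),
        ENNReal.ofReal_pow (by norm_num)]
      simp
    _ = 1 := by
      rw [mul_inv_cancel₀ (by positivity), ENNReal.ofReal_one]

theorem dimH_cantorSet_le : dimH cantorSet ≤ ENNReal.ofReal (log 2 / log 3) := by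
  have hs : 0 ≤ log 2 / log 3 := div_nonneg (log_nonneg (by norm_num)) (log_nonneg (by norm_num))
  refine dimH_le_of_hausdorffMeasure_ne_top (d := (log 2 / log 3).toNNReal) ?_
  rw [Real.coe_toNNReal _ hs]
  exact (hausdorffMeasure_cantorSet_le_one.trans_lt ENNReal.one_lt_top).ne

/-- The Hausdorff dimension of the middle-thirds Cantor set is `log 2 / log 3`,
the unique nonnegative solution of the Moran equation `2·(1/3)^s = 1` for its
defining ISS of two similarities of ratio `1/3`. -/
theorem dimH_cantorSet :
    dimH cantorSet = ENNReal.ofReal (Real.log 2 / Real.log 3) ∧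
    2 * (1 / 3 : ℝ) ^ (Real.log 2 / Real.log 3) = 1 ∧
    ∀ s : ℝ, 0 ≤ s → 2 * (1 / 3 : ℝ) ^ s = 1 → s = Real.log 2 / Real.log 3 := by
  have hmoran : 2 * (1 / 3 : ℝ) ^ (Real.log 2 / Real.log 3) = 1 := by
    rw [one_div, inv_rpow (by norm_num), three_rpow_log_two_div_log_three]
    norm_num
  refine ⟨le_antisymm dimH_cantorSet_le le_dimH_cantorSet, hmoran, fun s _ hs ↦ ?_⟩
  refine (Real.rpow_right_inj (x := 1 / 3) (by norm_num) (by norm_num)).mp ?_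
  linarith
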